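/- Let (X,d,μ) be a space of homogeneous type with dyadic lattice 𝒟, let S̃ ⊆ 𝒟 be a sparse family, let η be a weight, and for P ∈ 𝒟 write η_P := μ(P)^{-1}∫_P η dμ. Define A_{S̃}h := Σ_{R∈S̃} ⟨h⟩_R χ_R and A_{S̃,η}h := η · A_{S̃}h. Then for every l ∈ ℕ, every Q ∈ 𝒟 and every h ∈ L¹_loc(X): ∫_Q |h| ( Σ_{P∈S̃, P⊆Q} η_P χ_P )^l dμ ≤ C_l ∫_Q A^l_{S̃,η}(|h|) dμ, where A^l_{S̃,η} denotes the l-fold composition of A_{S̃,η} and C_l depends only on l (one may take C_l = l!). -/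

import Mathlib

open MeasureTheory ENNReal Set

noncomputable section

namespace SparsePaper

variable {X : Type*} [MeasurableSpace X]

/-- Quasi-metric ball. -/
def qball (d : X → X → ℝ) (z : X) (r : ℝ) : Set X := {y | d z y < r}

/-- `(X,d,μ)` is a space of homogeneous type with quasi-triangle constant `A₀` and
doubling constant `Cμ`. -/
structure IsSHT (d : X → X → ℝ) (μ : Measure X) (A₀ Cμ : ℝ) : Prop where
  one_le_A0 : 1 ≤ A₀
  one_le_Cmu : 1 ≤ Cμ
  d_nonneg : ∀ x y, 0 ≤ d x y
  d_self : ∀ x, d x x = 0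
  d_symm : ∀ x y, d x y = d y x
  d_triangle : ∀ x y z, d x y ≤ A₀ * (d x z + d z y)
  ball_measurable : ∀ z r, MeasurableSet (qball d z r)
  ball_pos : ∀ z r, 0 < r → 0 < μ (qball d z r)
  ball_lt_top : ∀ z r, 0 < r → μ (qball d z r) < ⊤
  doubling : ∀ z r, 0 < r → μ (qball d z (2 * r)) ≤ ENNReal.ofReal Cμ * μ (qball d z r)

/-- An abstract dyadic lattice (system of dyadic cubes) on `X`. -/
structure DyadicLattice (μ : Measure X) where
  cubes : Set (Set X)
  countable : cubes.Countable
  meas : ∀ Q ∈ cubes, MeasurableSet Q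
  vol_pos : ∀ Q ∈ cubes, 0 < μ Q
  vol_lt_top : ∀ Q ∈ cubes, μ Q < ⊤
  nested : ∀ Q ∈ cubes, ∀ Q' ∈ cubes, Q ⊆ Q' ∨ Q' ⊆ Q ∨ Q ∩ Q' = ∅

/-- `S` is a `δ`-sparse subfamily of the dyadic lattice `𝒟`. -/
def IsSparse (μ : Measure X) (𝒟 : DyadicLattice μ) (δ : ℝ) (S : Set (Set X)) : Prop :=
  S ⊆ 𝒟.cubes ∧
  ∃ E : Set X → Set X,
    (∀ Q ∈ S, E Q ⊆ Q ∧ MeasurableSet (E Q) ∧ ENNReal.ofReal δ * μ Q ≤ μ (E Q)) ∧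
    S.PairwiseDisjoint E

/-- Average of an `ℝ≥0∞`-valued function over `Q`. -/
def eAvg (μ : Measure X) (Q : Set X) (f : X → ℝ≥0∞) : ℝ≥0∞ := (∫⁻ x in Q, f x ∂μ) / μ Q

/-- `L^r` average `⟨f⟩_{Q,r}`. -/
def eAvgP (μ : Measure X) (Q : Set X) (r : ℝ) (f : X → ℝ≥0∞) : ℝ≥0∞ :=
  ((∫⁻ x in Q, f x ^ r ∂μ) / μ Q) ^ (1 / r)

/-- `σ`-weighted average `⟨f⟩_{σ,Q}`. -/
def wAvg (μ : Measure X) (σ : X → ℝ≥0∞) (Q : Set X) (f : X → ℝ≥0∞) : ℝ≥0∞ :=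
  (∫⁻ x in Q, f x * σ x ∂μ) / ∫⁻ x in Q, σ x ∂μ

/-- Real average `b_Q`. -/
def rAvg (μ : Measure X) (Q : Set X) (b : X → ℝ) : ℝ := ⨍ x in Q, b x ∂μ

/-- Hölder conjugate exponent `p' = p/(p-1)`. -/
def rconj (p : ℝ) : ℝ := p / (p - 1)

/-- Weighted `L^p` (quasi-)norm of an `ℝ≥0∞`-valued function. -/
def wLp (μ : Measure X) (w : X → ℝ≥0∞) (p : ℝ) (f : X → ℝ≥0∞) : ℝ≥0∞ :=
  (∫⁻ x, f x ^ p * w x ∂μ) ^ (1 / p)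

/-- Locally integrable (with respect to quasi-metric balls), i.e. `L¹_loc`. -/
def LocInt (d : X → X → ℝ) (μ : Measure X) (b : X → ℝ) : Prop :=
  Measurable b ∧ ∀ z r, 0 < r → IntegrableOn b (qball d z r) μ

/-- Bounded with bounded support (the class `L_b^∞(X)`). -/
def BddBddSupp (d : X → X → ℝ) (f : X → ℝ) : Prop :=
  Measurable f ∧ (∃ C, ∀ x, |f x| ≤ C) ∧ ∃ z R, 0 < R ∧ ∀ x, f x ≠ 0 → x ∈ qball d z R

variable {m : ℕ}

/-- Multilinear fractional sparse operator `𝒜_{η,S,p₀,γ}`. -/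
def spA (μ : Measure X) (S : Set (Set X)) (η p₀ γ : ℝ)
    (f : Fin m → X → ℝ≥0∞) (x : X) : ℝ≥0∞ :=
  (∑' Q : S, ((μ Q.1) ^ η * ∏ i, eAvgP μ Q.1 p₀ (f i)) ^ γ *
      Q.1.indicator (fun _ => (1 : ℝ≥0∞)) x) ^ (1 / γ)

/-- Multilinear fractional sparse operator `𝒜_{η,S}`. -/
def spA1 (μ : Measure X) (S : Set (Set X)) (η : ℝ)
    (f : Fin m → X → ℝ≥0∞) (x : X) : ℝ≥0∞ :=
  ∑' Q : S, (μ Q.1) ^ η * (∏ i, eAvg μ Q.1 (f i)) * Q.1.indicator (fun _ => (1 : ℝ≥0∞)) x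

/-- Multilinear fractional sparse operator `𝒜_{η,S,r}`. -/
def spAr (μ : Measure X) (S : Set (Set X)) (η r : ℝ)
    (f : Fin m → X → ℝ≥0∞) (x : X) : ℝ≥0∞ :=
  ∑' Q : S, (μ Q.1) ^ (η / r) * (∏ i, eAvgP μ Q.1 r (f i)) *
    Q.1.indicator (fun _ => (1 : ℝ≥0∞)) x

/-- First order multi-symbol multilinear fractional sparse operator `𝒜^{b}_{η,S,τ,r}`. -/
def spAb (μ : Measure X) (S : Set (Set X)) (η r : ℝ) (τ τℓ : Finset (Fin m))
    (b : Fin m → X → ℝ) (f : Fin m → X → ℝ≥0∞) (x : X) : ℝ≥0∞ :=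
  ∑' Q : S, (μ Q.1) ^ (η / r)
    * (∏ i ∈ τ, ENNReal.ofReal |b i x - rAvg μ Q.1 (b i)| * eAvgP μ Q.1 r (f i))
    * (∏ j ∈ τℓ \ τ,
        eAvgP μ Q.1 r (fun y => ENNReal.ofReal |b j y - rAvg μ Q.1 (b j)| * f j y))
    * (∏ l ∈ τℓᶜ, eAvgP μ Q.1 r (f l))
    * Q.1.indicator (fun _ => (1 : ℝ≥0∞)) x

/-- Higher order multi-symbol multilinear fractional sparse operator `𝒜^{b,k,t}_{η,S,τ,r}`. -/
def spAbkt (μ : Measure X) (S : Set (Set X)) (η r : ℝ) (τ : Finset (Fin m))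
    (b : Fin m → X → ℝ) (k t : Fin m → ℕ)
    (f : Fin m → X → ℝ≥0∞) (x : X) : ℝ≥0∞ :=
  ∑' Q : S, (μ Q.1) ^ (η / r)
    * (∏ i ∈ τ, ENNReal.ofReal |b i x - rAvg μ Q.1 (b i)| ^ (k i - t i)
        * eAvgP μ Q.1 r (fun y => f i y * ENNReal.ofReal (|b i y - rAvg μ Q.1 (b i)| ^ (t i))))
    * (∏ j ∈ τᶜ, eAvgP μ Q.1 r (f j))
    * Q.1.indicator (fun _ => (1 : ℝ≥0∞)) x

/-- The multilinear weight characteristic `[ω]_{A*_{p,q}}`. -/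
def AstarC (μ : Measure X) (𝒟 : DyadicLattice μ) (p : Fin m → ℝ) (q : ℝ)
    (ω : Fin m → X → ℝ≥0∞) : ℝ≥0∞ :=
  ⨆ Q ∈ 𝒟.cubes,
    eAvg μ Q (fun x => ∏ i, ω i x ^ (q / p i)) *
    ∏ i, (eAvg μ Q fun x => ω i x ^ (1 - rconj (p i))) ^ (q / rconj (p i))

/-- The two-weight characteristic `‖u, σ‖_{A*_{p,q}}`. -/
def AstarTwoC (μ : Measure X) (𝒟 : DyadicLattice μ) (p : Fin m → ℝ) (q : ℝ)
    (u : X → ℝ≥0∞) (σ : Fin m → X → ℝ≥0∞) : ℝ≥0∞ :=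
  ⨆ Q ∈ 𝒟.cubes, eAvg μ Q u * ∏ i, (eAvg μ Q (σ i)) ^ (q / rconj (p i))

/-- The weight characteristic `[ω]_{A*_{1⃗,q₀}}`. -/
def Astar1C (μ : Measure X) (𝒟 : DyadicLattice μ) (q₀ : ℝ)
    (ω : Fin m → X → ℝ≥0∞) : ℝ≥0∞ :=
  ⨆ Q ∈ 𝒟.cubes,
    eAvg μ Q (fun x => ∏ i, ω i x ^ q₀) *
    ∏ i, (essInf (ω i) (μ.restrict Q)) ^ (-q₀)

/-- Uncentered Hardy–Littlewood maximal operator over quasi-metric balls. -/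
def MHL (d : X → X → ℝ) (μ : Measure X) (f : X → ℝ≥0∞) (x : X) : ℝ≥0∞ :=
  ⨆ (z : X) (r : ℝ) (_ : 0 < r) (_ : x ∈ qball d z r), eAvg μ (qball d z r) f

/-- Fujii–Wilson `A_∞` characteristic. -/
def AinfC (d : X → X → ℝ) (μ : Measure X) (w : X → ℝ≥0∞) : ℝ≥0∞ :=
  ⨆ (z : X) (r : ℝ) (_ : 0 < r),
    (∫⁻ x in qball d z r, MHL d μ ((qball d z r).indicator w) x ∂μ) /
      ∫⁻ x in qball d z r, w x ∂μ

/-- Muckenhoupt `A_p` characteristic. -/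
def ApC (d : X → X → ℝ) (μ : Measure X) (p : ℝ) (w : X → ℝ≥0∞) : ℝ≥0∞ :=
  ⨆ (z : X) (r : ℝ) (_ : 0 < r),
    eAvg μ (qball d z r) w *
      (eAvg μ (qball d z r) fun x => w x ^ (1 - rconj p)) ^ (p - 1)

/-- BMO norm. -/
def eBMO (d : X → X → ℝ) (μ : Measure X) (b : X → ℝ) : ℝ≥0∞ :=
  ⨆ (z : X) (r : ℝ) (_ : 0 < r),
    (∫⁻ x in qball d z r, ENNReal.ofReal |b x - rAvg μ (qball d z r) b| ∂μ) /
      μ (qball d z r)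

/-- Weighted BMO norm `‖b‖_{BMO_ν}`. -/
def eBMOw (d : X → X → ℝ) (μ : Measure X) (ν : X → ℝ≥0∞) (b : X → ℝ) : ℝ≥0∞ :=
  ⨆ (z : X) (r : ℝ) (_ : 0 < r),
    (∫⁻ x in qball d z r, ENNReal.ofReal |b x - rAvg μ (qball d z r) b| ∂μ) /
      ∫⁻ x in qball d z r, ν x ∂μ

/-- The `W^∞_{p,q}` characteristic. -/
def WinfC (d : X → X → ℝ) (μ : Measure X) (𝒟 : DyadicLattice μ) (p : Fin m → ℝ) (q : ℝ)
    (σ : Fin m → X → ℝ≥0∞) : ℝ≥0∞ :=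
  ⨆ Q ∈ 𝒟.cubes,
    (∫⁻ x in Q, ∏ i, MHL d μ (Q.indicator (σ i)) x ^ (q / p i) ∂μ) /
      ∫⁻ x in Q, ∏ i, σ i x ^ (q / p i) ∂μ

/-- The auxiliary characteristic `[σ⃗^i]_{W^∞_{(p,q)^i}}`. -/
def WinfCi (d : X → X → ℝ) (μ : Measure X) (𝒟 : DyadicLattice μ) (p : Fin m → ℝ) (q γ : ℝ)
    (u : X → ℝ≥0∞) (σ : Fin m → X → ℝ≥0∞) (i : Fin m) : ℝ≥0∞ :=
  if q ≤ γ then 1 else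
  ⨆ Q ∈ 𝒟.cubes,
    (∫⁻ x in Q, MHL d μ (Q.indicator u) x ^ (rconj (p i / γ) / rconj (q / γ)) *
        ∏ j ∈ Finset.univ.erase i,
          MHL d μ (Q.indicator (σ j)) x ^ (rconj (p i / γ) / (p j / γ)) ∂μ) /
      ∫⁻ x in Q, u x ^ (rconj (p i / γ) / rconj (q / γ)) *
        ∏ j ∈ Finset.univ.erase i, σ j x ^ (rconj (p i / γ) / (p j / γ)) ∂μ

/-- `exp(⟨log w⁻¹⟩_Q)`. -/
def expLogInv (μ : Measure X) (Q : Set X) (w : X → ℝ≥0∞) : ℝ≥0∞ :=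
  ENNReal.ofReal (Real.exp (⨍ x in Q, -Real.log (w x).toReal ∂μ))

/-- The `H^∞_{p,q}` characteristic. -/
def HinfC (μ : Measure X) (𝒟 : DyadicLattice μ) (p : Fin m → ℝ) (q : ℝ)
    (σ : Fin m → X → ℝ≥0∞) : ℝ≥0∞ :=
  ⨆ Q ∈ 𝒟.cubes, ∏ i, (eAvg μ Q (σ i)) ^ (q / p i) * expLogInv μ Q (σ i) ^ (q / p i)

/-- The auxiliary characteristic `[σ⃗^i]_{H^∞_{(p,q)^i}}`. -/
def HinfCi (μ : Measure X) (𝒟 : DyadicLattice μ) (p : Fin m → ℝ) (q γ : ℝ)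
    (u : X → ℝ≥0∞) (σ : Fin m → X → ℝ≥0∞) (i : Fin m) : ℝ≥0∞ :=
  if q ≤ γ then 1 else
  ⨆ Q ∈ 𝒟.cubes,
    (eAvg μ Q u) ^ (rconj (p i) * max (1 / γ - 1 / q) 0) *
    expLogInv μ Q u ^ (rconj (p i) * max (1 / γ - 1 / q) 0) *
    ∏ j ∈ Finset.univ.erase i,
      (eAvg μ Q (σ i)) ^ (rconj (p i) / p j) * expLogInv μ Q (σ i) ^ (rconj (p i) / p j)

/-- Normalized Luxemburg norm `‖f‖_{Φ,Q}`. -/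
def luxNorm (μ : Measure X) (Q : Set X) (Φ : ℝ≥0∞ → ℝ≥0∞) (f : X → ℝ≥0∞) : ℝ≥0∞ :=
  sInf {t : ℝ≥0∞ | t ≠ 0 ∧ ∫⁻ x in Q, Φ (f x / t) ∂μ ≤ μ Q}

/-- The Young function `t (1 + log⁺ t)^r` for `L(log L)^r`. -/
def PhiLlogL (r : ℝ) (s : ℝ≥0∞) : ℝ≥0∞ :=
  s * (1 + ENNReal.ofReal (max (Real.log s.toReal) 0)) ^ r

/-- The function `Φ_{r,ℓ}(t) = t^r (1 + (log⁺ t)^{rℓ})`. -/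
def PhiRL (r l : ℝ) (s : ℝ≥0∞) : ℝ≥0∞ :=
  s ^ r * (1 + ENNReal.ofReal (max (Real.log s.toReal) 0 ^ (r * l)))

/-- Multilinear weighted operator (quasi-)norm `∏ L^{p_i}(ω_i) → L^q(u)`. -/
def mOpNorm (μ : Measure X) (p : Fin m → ℝ) (ω : Fin m → X → ℝ≥0∞) (q : ℝ) (u : X → ℝ≥0∞)
    (A : (Fin m → X → ℝ≥0∞) → X → ℝ≥0∞) : ℝ≥0∞ :=
  sInf {c : ℝ≥0∞ | ∀ f : Fin m → X → ℝ≥0∞, (∀ i, Measurable (f i)) →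
    wLp μ u q (A f) ≤ c * ∏ i, wLp μ (ω i) (p i) (f i)}

/-- A quasi-norm on a real vector space (so that `B` is a quasi-Banach space). -/
structure QuasiNorm (B : Type*) [AddCommGroup B] [Module ℝ B] where
  N : B → ℝ
  nonneg : ∀ x, 0 ≤ N x
  map_zero : N 0 = 0
  map_smul : ∀ (c : ℝ) (x : B), N (c • x) = |c| * N x
  κ : ℝ
  one_le_κ : 1 ≤ κ
  add_le : ∀ x y, N (x + y) ≤ κ * (N x + N y)

/-- Unweighted `L^r` norm of a real function. -/
def rLr (μ : Measure X) (r : ℝ) (f : X → ℝ) : ℝ≥0∞ :=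
  (∫⁻ x, ENNReal.ofReal |f x| ^ r ∂μ) ^ (1 / r)

/-- Weak `L^{r̃}` quasi-norm of a `B`-valued function. -/
def wkLr {B : Type*} [AddCommGroup B] [Module ℝ B] (QN : QuasiNorm B)
    (μ : Measure X) (rt : ℝ) (g : X → B) : ℝ≥0∞ :=
  ⨆ (t : ℝ) (_ : 0 < t), ENNReal.ofReal t * μ {x | t < QN.N (g x)} ^ (1 / rt)

/-- Weak `L^{r̃}` quasi-norm of an `ℝ≥0∞`-valued function. -/
def wkLrE (μ : Measure X) (rt : ℝ) (g : X → ℝ≥0∞) : ℝ≥0∞ :=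
  ⨆ (t : ℝ) (_ : 0 < t), ENNReal.ofReal t * μ {x | ENNReal.ofReal t < g x} ^ (1 / rt)

/-- Weak-type operator norm `L^r × ⋯ × L^r → L^{r̃,∞}` of a `B`-valued multilinear operator. -/
def wkOpNorm {B : Type*} [AddCommGroup B] [Module ℝ B] (QN : QuasiNorm B)
    (μ : Measure X) (r rt : ℝ) (T : (Fin m → X → ℝ) → X → B) : ℝ≥0∞ :=
  sInf {c : ℝ≥0∞ | ∀ f : Fin m → X → ℝ, (∀ i, Measurable (f i)) →
    wkLr QN μ rt (T f) ≤ c * ∏ i, rLr μ r (f i)}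

/-- Weak-type operator norm of an `ℝ≥0∞`-valued multilinear operator. -/
def wkOpNormE (μ : Measure X) (r rt : ℝ) (M : (Fin m → X → ℝ) → X → ℝ≥0∞) : ℝ≥0∞ :=
  sInf {c : ℝ≥0∞ | ∀ f : Fin m → X → ℝ, (∀ i, Measurable (f i)) →
    wkLrE μ rt (M f) ≤ c * ∏ i, rLr μ r (f i)}

/-- Conjugate exponent, as an extended real (`∞` for `r = 1`). -/
def conjE (r : ℝ) : ℝ≥0∞ := if r = 1 then ⊤ else ENNReal.ofReal (r / (r - 1))

/-- The `B`-valued `m`-linear `L^r`-Hörmander constant of a kernel `K`. -/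
def hormC {B : Type*} [AddCommGroup B] [Module ℝ B] (QN : QuasiNorm B)
    (d : X → X → ℝ) (μ : Measure X) (r : ℝ) (K : X → (Fin m → X) → B) : ℝ≥0∞ :=
  ⨆ (z : X) (ρ : ℝ) (_ : 0 < ρ) (x : X) (_ : x ∈ qball d z (ρ / 2))
      (x' : X) (_ : x' ∈ qball d z (ρ / 2)),
    ∑' n : ℕ,
      μ (qball d z (2 ^ (n + 1) * ρ)) ^ ((m : ℝ) / r) *
      eLpNorm (fun y : Fin m → X => QN.N (K x y - K x' y)) (conjE r)
        ((Measure.pi fun _ : Fin m => μ).restrict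
          (Set.univ.pi (fun _ : Fin m => qball d z (2 ^ (n + 1) * ρ)) \
           Set.univ.pi fun _ : Fin m => qball d z (2 ^ n * ρ)))

/-- Grand maximal truncated operator `ℳ_T`. -/
def grandMax {B : Type*} [AddCommGroup B] [Module ℝ B] (QN : QuasiNorm B)
    (d : X → X → ℝ) (μ : Measure X) (Cj : ℝ)
    (T : (Fin m → X → ℝ) → X → B) (f : Fin m → X → ℝ) (x : X) : ℝ≥0∞ :=
  ⨆ (z : X) (ρ : ℝ) (_ : 0 < ρ) (_ : x ∈ qball d z ρ),
    essSup
      (fun ξ => ENNReal.ofReal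
        (QN.N (T (fun i => ((qball d z (Cj * ρ))ᶜ).indicator (f i)) ξ)))
      (μ.restrict (qball d z ρ))

/-- Local grand maximal truncated operator `ℳ_{T,B₀}`. -/
def grandMaxLoc {B : Type*} [AddCommGroup B] [Module ℝ B] (QN : QuasiNorm B)
    (d : X → X → ℝ) (μ : Measure X) (Cj : ℝ)
    (T : (Fin m → X → ℝ) → X → B) (z₀ : X) (ρ₀ : ℝ)
    (f : Fin m → X → ℝ) (x : X) : ℝ≥0∞ :=
  ⨆ (z : X) (ρ : ℝ) (_ : 0 < ρ) (_ : x ∈ qball d z ρ) (_ : qball d z ρ ⊆ qball d z₀ ρ₀),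
    essSup
      (fun ξ => ENNReal.ofReal
        (QN.N (T (fun i => (qball d z₀ (Cj * ρ₀) \ qball d z (Cj * ρ)).indicator (f i)) ξ)))
      (μ.restrict (qball d z ρ))

/-- Generalized commutator `T^{b,k}_{τℓ}`. -/
def commT {B : Type*} (T : (Fin m → X → ℝ) → X → B) (τℓ : Finset (Fin m))
    (b : Fin m → X → ℝ) (k : Fin m → ℕ) (f : Fin m → X → ℝ) : X → B :=
  fun x => T (fun i y => (if i ∈ τℓ then (b i x - b i y) ^ k i else 1) * f i y) x

/-- `M_ε`. -/
def Meps (d : X → X → ℝ) (μ : Measure X) (ε : ℝ) (f : X → ℝ≥0∞) (x : X) : ℝ≥0∞ :=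
  (MHL d μ (fun y => f y ^ ε) x) ^ (1 / ε)

/-- Dyadic sharp maximal operator. -/
def sharpD (μ : Measure X) (𝒟 : DyadicLattice μ) (f : X → ℝ≥0∞) (x : X) : ℝ≥0∞ :=
  ⨆ (Q ∈ 𝒟.cubes) (_ : x ∈ Q),
    eAvg μ Q (fun y => (f y - eAvg μ Q f) + (eAvg μ Q f - f y))

/-- `M^♯_{𝒟,δ}`. -/
def sharpDd (μ : Measure X) (𝒟 : DyadicLattice μ) (δ : ℝ) (f : X → ℝ≥0∞) (x : X) : ℝ≥0∞ :=
  (sharpD μ 𝒟 (fun y => f y ^ δ) x) ^ (1 / δ)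

/-- The sparse averaging operator `A_S`. -/
def ASop (μ : Measure X) (S : Set (Set X)) (h : X → ℝ≥0∞) (x : X) : ℝ≥0∞ :=
  ∑' R : S, eAvg μ R.1 h * R.1.indicator (fun _ => (1 : ℝ≥0∞)) x

/-- The weighted sparse averaging operator `A_{S,η} h = η ⋅ A_S h`. -/
def ASopW (μ : Measure X) (S : Set (Set X)) (w : X → ℝ≥0∞) (h : X → ℝ≥0∞) (x : X) : ℝ≥0∞ :=
  w x * ASop μ S h x

/-- Multilinear fractional dyadic Orlicz maximal operator. -/
def MOrlicz (μ : Measure X) (𝒟 : DyadicLattice μ) (η : ℝ) (Φ : Fin m → ℝ≥0∞ → ℝ≥0∞)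
    (f : Fin m → X → ℝ≥0∞) (x : X) : ℝ≥0∞ :=
  ⨆ (Q ∈ 𝒟.cubes) (_ : x ∈ Q), (μ Q) ^ η * ∏ i, luxNorm μ Q (Φ i) (f i)

/-- Composition `Φ₁ ∘ ⋯ ∘ Φ_m`. -/
def compAll (Φ : Fin m → ℝ≥0∞ → ℝ≥0∞) : ℝ≥0∞ → ℝ≥0∞ :=
  (List.ofFn Φ).foldr (· ∘ ·) id

/-- The operator `Δ^{b,σ}_{η,S,τ}`. -/
def DeltaOp (d : X → X → ℝ) (μ : Measure X) (S : Set (Set X)) (η r : ℝ)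
    (τ σf : Finset (Fin m)) (b : Fin m → X → ℝ) (f : Fin m → X → ℝ≥0∞) (x : X) : ℝ≥0∞ :=
  ∑' Q : S, (μ Q.1) ^ (η / r)
    * (∏ i ∈ σf, ENNReal.ofReal |b i x - rAvg μ Q.1 (b i)|)
    * (∏ i ∈ τ, eAvgP μ Q.1 r (f i))
    * (∏ j ∈ τᶜ, eBMO d μ (b j) * (luxNorm μ Q.1 (PhiLlogL r) fun y => f j y ^ r) ^ (1 / r))
    * Q.1.indicator (fun _ => (1 : ℝ≥0∞)) x

/-- The sparse operator `𝒜^{τᶜ}_{η,S,L(log L)^r}`. -/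
def spALlogL (μ : Measure X) (S : Set (Set X)) (η r : ℝ) (τ : Finset (Fin m))
    (f : Fin m → X → ℝ≥0∞) (x : X) : ℝ≥0∞ :=
  ∑' Q : S, (μ Q.1) ^ (η / r)
    * (∏ i ∈ τ, eAvgP μ Q.1 r (f i))
    * (∏ j ∈ τᶜ, (luxNorm μ Q.1 (PhiLlogL r) fun y => f j y ^ r) ^ (1 / r))
    * Q.1.indicator (fun _ => (1 : ℝ≥0∞)) x

/-- The maximal operator `ℳ^{τᶜ}_{η,L(log L)^r}`. -/
def MLlogL (μ : Measure X) (𝒟 : DyadicLattice μ) (η r : ℝ) (τ : Finset (Fin m))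
    (f : Fin m → X → ℝ≥0∞) (x : X) : ℝ≥0∞ :=
  ⨆ (Q ∈ 𝒟.cubes) (_ : x ∈ Q),
    (μ Q) ^ (η / r) * (∏ i ∈ τ, eAvg μ Q (f i)) * ∏ j ∈ τᶜ, luxNorm μ Q (PhiLlogL r) (f j)

theorem add_pow_succ_le (s a : ℝ≥0∞) (n : ℕ) :
    (s + a) ^ (n + 1) ≤ s ^ (n + 1) + (n + 1 : ℕ) * (a * (s + a) ^ n) := by
  induction n with
  | zero => simp
  | succ n ih =>
    calc (s + a) ^ (n + 1 + 1) = (s + a) ^ (n + 1) * s + a * (s + a) ^ (n + 1) := by ring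
      _ ≤ (s ^ (n + 1) + (n + 1 : ℕ) * (a * (s + a) ^ n)) * s + a * (s + a) ^ (n + 1) := by
        gcongr
      _ = s ^ (n + 1 + 1) + (n + 1 : ℕ) * (a * ((s + a) ^ n * s)) + a * (s + a) ^ (n + 1) := by
        ring
      _ ≤ s ^ (n + 1 + 1) + (n + 1 : ℕ) * (a * ((s + a) ^ n * (s + a)))
          + a * (s + a) ^ (n + 1) := by
        gcongr
        exact le_self_add
      _ = s ^ (n + 1 + 1) + (n + 1 + 1 : ℕ) * (a * (s + a) ^ (n + 1)) := by
        push_cast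
        ring

open Classical in
/-- A power of a finite sum over an (essentially) totally ordered index set is controlled by
partial sums. -/
theorem finset_sum_pow_succ_le {α : Type*} [PartialOrder α] (b : α → ℝ≥0∞) (n : ℕ) (F : Finset α)
    (hF : ∀ i ∈ F, ∀ j ∈ F, i ≤ j ∨ j ≤ i ∨ b i = 0 ∨ b j = 0) :
    (∑ i ∈ F, b i) ^ (n + 1)
      ≤ (n + 1 : ℕ) * ∑ i ∈ F, b i * (∑ j ∈ F with j ≤ i, b j) ^ n := by
  induction F using Finset.strongInduction with
  | H F ih =>
    rcases F.eq_empty_or_nonempty with rfl | hne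
    · simp
    obtain ⟨m, hm⟩ := F.exists_maximal hne
    have hmF : m ∈ F := hm.prop
    have hlast : b m * (∑ j ∈ F, b j) ^ n ≤ b m * (∑ j ∈ F with j ≤ m, b j) ^ n := by
      by_cases hb : b m = 0
      · simp [hb]
      refine le_of_eq ?_
      congr 2
      symm
      refine Finset.sum_subset (Finset.filter_subset _ _) fun j hj hj' => ?_
      have hjm : ¬ j ≤ m := fun h => hj' (Finset.mem_filter.2 ⟨hj, h⟩)
      rcases hF m hmF j hj with h | h | h | h
      · exact absurd (hm.le_of_ge hj h) hjm
      · exact absurd h hjm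
      · exact absurd h hb
      · exact h
    have hrec := ih (F.erase m) (Finset.erase_ssubset hmF) fun i hi j hj =>
      hF i (Finset.mem_of_mem_erase hi) j (Finset.mem_of_mem_erase hj)
    have hsum : ∑ i ∈ F, b i = ∑ i ∈ F.erase m, b i + b m := (Finset.sum_erase_add F b hmF).symm
    calc (∑ i ∈ F, b i) ^ (n + 1)
        ≤ (∑ i ∈ F.erase m, b i) ^ (n + 1) + (n + 1 : ℕ) * (b m * (∑ i ∈ F, b i) ^ n) := by
          rw [hsum]
          exact add_pow_succ_le _ _ n
      _ ≤ (n + 1 : ℕ) * ∑ i ∈ F.erase m, b i * (∑ j ∈ F.erase m with j ≤ i, b j) ^ n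
          + (n + 1 : ℕ) * (b m * (∑ j ∈ F with j ≤ m, b j) ^ n) := by
          gcongr
      _ ≤ (n + 1 : ℕ) * ∑ i ∈ F.erase m, b i * (∑ j ∈ F with j ≤ i, b j) ^ n
          + (n + 1 : ℕ) * (b m * (∑ j ∈ F with j ≤ m, b j) ^ n) := by
          gcongr
          exact Finset.erase_subset _ _
      _ = (n + 1 : ℕ) * ∑ i ∈ F, b i * (∑ j ∈ F with j ≤ i, b j) ^ n := by
          rw [← mul_add, Finset.sum_erase_add F _ hmF]

theorem tsum_pow_succ_le {α : Type*} [PartialOrder α] (S : Set α) (q : α) (b : α → ℝ≥0∞)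
    (hS : ∀ i ∈ S, ∀ j ∈ S, i ≤ j ∨ j ≤ i ∨ b i = 0 ∨ b j = 0) (n : ℕ) :
    (∑' i : {i : α // i ∈ S ∧ i ≤ q}, b i) ^ (n + 1)
      ≤ (n + 1 : ℕ) * ∑' i : {i : α // i ∈ S ∧ i ≤ q},
          b i * (∑' j : {j : α // j ∈ S ∧ j ≤ i.1}, b j) ^ n := by
  classical
  have hlim : Filter.Tendsto
      (fun F : Finset {i : α // i ∈ S ∧ i ≤ q} => (∑ i ∈ F, b i) ^ (n + 1)) Filter.atTop
      (nhds ((∑' i : {i : α // i ∈ S ∧ i ≤ q}, b i) ^ (n + 1))) :=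
    ((ENNReal.continuous_pow (n + 1)).tendsto _).comp ENNReal.summable.hasSum
  refine le_of_tendsto' hlim fun F => ?_
  refine (finset_sum_pow_succ_le (fun i : {i : α // i ∈ S ∧ i ≤ q} => b i) n F
    fun i _ j _ => hS i i.2.1 j j.2.1).trans ?_
  gcongr
  refine le_trans ?_ (ENNReal.sum_le_tsum F)
  gcongr with i hi
  rw [← Finset.tsum_subtype]
  exact ENNReal.tsum_comp_le_tsum_of_injective
    (f := fun j : {j // j ∈ F.filter (· ≤ i)} =>
      (⟨j.1.1, j.1.2.1, (Finset.mem_filter.1 j.2).2⟩ : {j : α // j ∈ S ∧ j ≤ i.1}))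
    (fun j k hjk => Subtype.ext (Subtype.ext (Subtype.mk.inj hjk)))
    (fun j => b j)

theorem setLIntegral_indicator_one_mul (μ : Measure X) {P Q : Set X} (hP : MeasurableSet P)
    (hPQ : P ⊆ Q) (g : X → ℝ≥0∞) :
    ∫⁻ x in Q, P.indicator (fun _ => (1 : ℝ≥0∞)) x * g x ∂μ = ∫⁻ x in P, g x ∂μ := by
  have : (fun x => P.indicator (fun _ => (1 : ℝ≥0∞)) x * g x) = P.indicator g := by
    ext x
    by_cases hx : x ∈ P <;> simp [hx]
  rw [this, setLIntegral_indicator hP, inter_eq_left.2 hPQ]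

theorem measurable_tsum_mul_indicator {ι : Type*} [Countable ι] (c : ι → ℝ≥0∞) {s : ι → Set X}
    (hs : ∀ i, MeasurableSet (s i)) :
    Measurable fun x => ∑' i, c i * (s i).indicator (fun _ => (1 : ℝ≥0∞)) x :=
  Measurable.tsum fun i => (measurable_const.indicator (hs i)).const_mul _

theorem measurable_iterate_ASopW (μ : Measure X) {S : Set (Set X)} (hc : S.Countable)
    (hS : ∀ P ∈ S, MeasurableSet P) {w : X → ℝ≥0∞} (hw : Measurable w)
    {h : X → ℝ≥0∞} (hh : Measurable h) (l : ℕ) : Measurable ((ASopW μ S w)^[l] h) := by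
  have := hc.to_subtype
  induction l with
  | zero => exact hh
  | succ l ih =>
    rw [Function.iterate_succ_apply']
    exact hw.mul (measurable_tsum_mul_indicator _ fun R : S => hS R R.2)

theorem tsum_eAvg_mul_setLIntegral_le (μ : Measure X) {S : Set (Set X)} (hc : S.Countable)
    (hS : ∀ P ∈ S, MeasurableSet P) {w : X → ℝ≥0∞} (hw : Measurable w) (f : X → ℝ≥0∞)
    (Q : Set X) :
    ∑' P : {P : Set X // P ∈ S ∧ P ⊆ Q}, eAvg μ P.1 w * ∫⁻ x in P.1, f x ∂μ
      ≤ ∫⁻ x in Q, ASopW μ S w f x ∂μ := by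
  have := hc.to_subtype
  let T : {P : Set X // P ∈ S ∧ P ⊆ Q} → S := fun P => ⟨P.1, P.2.1⟩
  have hT : Function.Injective T := fun P R hPR => Subtype.ext (Subtype.mk.inj hPR)
  have : Countable {P : Set X // P ∈ S ∧ P ⊆ Q} := hT.countable
  have hind (P : {P : Set X // P ∈ S ∧ P ⊆ Q}) :
      Measurable fun x => P.1.indicator (fun _ => (1 : ℝ≥0∞)) x * w x :=
    (measurable_const.indicator (hS P P.2.1)).mul hw
  calc ∑' P : {P : Set X // P ∈ S ∧ P ⊆ Q}, eAvg μ P.1 w * ∫⁻ x in P.1, f x ∂μ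
      = ∑' P : {P : Set X // P ∈ S ∧ P ⊆ Q},
          ∫⁻ x in Q, eAvg μ P.1 f * (P.1.indicator (fun _ => (1 : ℝ≥0∞)) x * w x) ∂μ := by
        congr 1 with P
        rw [lintegral_const_mul _ (hind P),
          setLIntegral_indicator_one_mul μ (hS P P.2.1) P.2.2]
        simp only [eAvg, div_eq_mul_inv]
        ring
    _ = ∫⁻ x in Q, ∑' P : {P : Set X // P ∈ S ∧ P ⊆ Q},
          eAvg μ P.1 f * (P.1.indicator (fun _ => (1 : ℝ≥0∞)) x * w x) ∂μ :=
        (lintegral_tsum fun P => ((hind P).const_mul _).aemeasurable).symm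
    _ ≤ ∫⁻ x in Q, ASopW μ S w f x ∂μ := by
        refine lintegral_mono fun x => ?_
        simp only [ASopW, ASop, ← mul_assoc]
        rw [ENNReal.tsum_mul_right, mul_comm]
        gcongr
        exact ENNReal.tsum_comp_le_tsum_of_injective hT
          fun R => eAvg μ R.1 f * R.1.indicator (fun _ => (1 : ℝ≥0∞)) x

/-- the iteration lemma for sparse averaging operators:
`∫_Q |h| (Σ_{P∈S̃, P⊆Q} η_P χ_P)^l ≤ l! ∫_Q A^l_{S̃,η}(|h|)`. -/
theorem statement18
    (d : X → X → ℝ) (μ : Measure X) (A₀ Cμ : ℝ) (hX : IsSHT d μ A₀ Cμ)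
    (𝒟 : DyadicLattice μ) (δ : ℝ) (hδ0 : 0 < δ) (hδ1 : δ < 1)
    (St : Set (Set X)) (hSt : IsSparse μ 𝒟 δ St)
    (w : X → ℝ≥0∞) (hw : Measurable w) :
    ∀ (l : ℕ) (Q : Set X), Q ∈ 𝒟.cubes →
      ∀ h : X → ℝ≥0∞, Measurable h →
        (∫⁻ x in Q, h x *
            (∑' P : {P : Set X // P ∈ St ∧ P ⊆ Q},
              eAvg μ P.1 w * P.1.indicator (fun _ => (1 : ℝ≥0∞)) x) ^ l ∂μ)
          ≤ (Nat.factorial l : ℝ≥0∞) * ∫⁻ x in Q, (ASopW μ St w)^[l] h x ∂μ := by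
  have hSD := hSt.1
  have hc : St.Countable := 𝒟.countable.mono hSD
  have hS : ∀ P ∈ St, MeasurableSet P := fun P hP => 𝒟.meas P (hSD hP)
  have hcount (Q : Set X) : Countable {P : Set X // P ∈ St ∧ P ⊆ Q} :=
    (hc.mono fun _ hP => hP.1 : {P | P ∈ St ∧ P ⊆ Q}.Countable).to_subtype
  intro l
  induction l with
  | zero => intro Q hQ h hh; simp
  | succ l ih =>
    intro Q hQ h hh
    have := hcount Q
    set T : Set X → X → ℝ≥0∞ := fun Q x => ∑' P : {P : Set X // P ∈ St ∧ P ⊆ Q},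
      eAvg μ P.1 w * P.1.indicator (fun _ => (1 : ℝ≥0∞)) x
    have hTm (Q : Set X) : Measurable (T Q) :=
      measurable_tsum_mul_indicator _ fun P : {P : Set X // P ∈ St ∧ P ⊆ Q} => hS P P.2.1
    have hgm (P : {P : Set X // P ∈ St ∧ P ⊆ Q}) :
        Measurable fun x => P.1.indicator (fun _ => (1 : ℝ≥0∞)) x * (h x * T P.1 x ^ l) :=
      (measurable_const.indicator (hS P P.2.1)).mul (hh.mul ((hTm P.1).pow_const l))
    have hpt (x : X) : h x * T Q x ^ (l + 1) ≤ (l + 1 : ℕ) *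
        ∑' P : {P : Set X // P ∈ St ∧ P ⊆ Q}, eAvg μ P.1 w *
          (P.1.indicator (fun _ => (1 : ℝ≥0∞)) x * (h x * T P.1 x ^ l)) := by
      have hchain : ∀ P ∈ St, ∀ R ∈ St, P ≤ R ∨ R ≤ P ∨
          eAvg μ P w * P.indicator (fun _ => (1 : ℝ≥0∞)) x = 0 ∨
          eAvg μ R w * R.indicator (fun _ => (1 : ℝ≥0∞)) x = 0 := by
        intro P hP R hR
        rcases 𝒟.nested P (hSD hP) R (hSD hR) with h1 | h1 | h1
        · exact .inl h1
        · exact .inr (.inl h1)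
        · by_cases hxP : x ∈ P
          · have hxR : x ∉ R := fun hxR => (h1 ▸ ⟨hxP, hxR⟩ : x ∈ (∅ : Set X))
            simp [hxR]
          · simp [hxP]
      calc h x * T Q x ^ (l + 1)
          ≤ h x * ((l + 1 : ℕ) * ∑' P : {P : Set X // P ∈ St ∧ P ⊆ Q},
              eAvg μ P.1 w * P.1.indicator (fun _ => (1 : ℝ≥0∞)) x * T P.1 x ^ l) := by
            gcongr
            exact tsum_pow_succ_le St Q
              (fun P => eAvg μ P w * P.indicator (fun _ => (1 : ℝ≥0∞)) x) hchain l
        _ = _ := by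
            rw [mul_left_comm, ← ENNReal.tsum_mul_left]
            congr 2 with P
            ring
    calc ∫⁻ x in Q, h x * T Q x ^ (l + 1) ∂μ
        ≤ ∫⁻ x in Q, (l + 1 : ℕ) * ∑' P : {P : Set X // P ∈ St ∧ P ⊆ Q}, eAvg μ P.1 w *
            (P.1.indicator (fun _ => (1 : ℝ≥0∞)) x * (h x * T P.1 x ^ l)) ∂μ :=
          lintegral_mono hpt
      _ = (l + 1 : ℕ) * ∑' P : {P : Set X // P ∈ St ∧ P ⊆ Q}, eAvg μ P.1 w *
            ∫⁻ x in P.1, h x * T P.1 x ^ l ∂μ := by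
          rw [lintegral_const_mul _ (Measurable.tsum fun P => (hgm P).const_mul _),
            lintegral_tsum fun P => ((hgm P).const_mul _).aemeasurable]
          congr 2 with P
          rw [lintegral_const_mul _ (hgm P),
            setLIntegral_indicator_one_mul μ (hS P P.2.1) P.2.2]
      _ ≤ (l + 1 : ℕ) * ∑' P : {P : Set X // P ∈ St ∧ P ⊆ Q}, eAvg μ P.1 w *
            ((Nat.factorial l : ℝ≥0∞) * ∫⁻ x in P.1, (ASopW μ St w)^[l] h x ∂μ) := by
          gcongr with P
          exact ih P.1 (hSD P.2.1) h hh
      _ = (Nat.factorial (l + 1) : ℝ≥0∞) * ∑' P : {P : Set X // P ∈ St ∧ P ⊆ Q},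
            eAvg μ P.1 w * ∫⁻ x in P.1, (ASopW μ St w)^[l] h x ∂μ := by
          simp only [mul_left_comm (eAvg μ _ w)]
          rw [ENNReal.tsum_mul_left, ← mul_assoc, Nat.factorial_succ, Nat.cast_mul]
      _ ≤ (Nat.factorial (l + 1) : ℝ≥0∞) * ∫⁻ x in Q, (ASopW μ St w)^[l + 1] h x ∂μ := by
          rw [Function.iterate_succ_apply']
          gcongr
          exact tsum_eAvg_mul_setLIntegral_le μ hc hS hw _ Q

end SparsePaper
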